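/- Let A be a closed, monotone, quasidense subset of E × E*. Then A is maximally monotone of type (ANA): for every (w, w*) ∈ (E × E*) \ A and every ε > 0, there exists (s, s*) ∈ A with s ≠ w, s* ≠ w* and ⟨s − w, s* − w*⟩ / (‖s − w‖·‖s* − w*‖) < −1 + ε. -/

import Mathlib

noncomputable section

open Filter Topology

variable {E : Type*} [NormedAddCommGroup E] [NormedSpace ℝ E]

/-- `A ⊆ E × E*` is a monotone set. -/
def MonotoneSet (A : Set (E × (E →L[ℝ] ℝ))) : Prop :=
  A.Nonempty ∧ ∀ p ∈ A, ∀ q ∈ A, 0 ≤ (p.2 - q.2) (p.1 - q.1)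

/-- `A ⊆ E × E*` is maximally monotone. -/
def MaxMonotone (A : Set (E × (E →L[ℝ] ℝ))) : Prop :=
  MonotoneSet A ∧ ∀ A' : Set (E × (E →L[ℝ] ℝ)), MonotoneSet A' → A ⊆ A' → A' = A

/-- `r_L((s,s*) - (x,x*)) = (1/2)‖s - x‖² + (1/2)‖s* - x*‖² + ⟨s - x, s* - x*⟩`. -/
def rQ (q p : E × (E →L[ℝ] ℝ)) : ℝ :=
  (1 / 2) * ‖q.1 - p.1‖ ^ 2 + (1 / 2) * ‖q.2 - p.2‖ ^ 2 + (q.2 - p.2) (q.1 - p.1)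

/-- `A ⊆ E × E*` is quasidense. -/
def Quasidense (A : Set (E × (E →L[ℝ] ℝ))) : Prop :=
  ∀ p : E × (E →L[ℝ] ℝ), (⨅ q ∈ A, ((rQ q p : ℝ) : EReal)) ≤ 0

/-- `A ⊆ E × E*` is stably quasidense (with the norm
`‖(x, x*)‖ = (‖x‖² + ‖x*‖²)^{1/2}` on `E × E*`). -/
def StablyQuasidense (A : Set (E × (E →L[ℝ] ℝ))) : Prop :=
  ∀ p : E × (E →L[ℝ] ℝ), ∃ K : ℝ, 0 ≤ K ∧
    (⨅ q ∈ {q ∈ A | Real.sqrt (‖q.1 - p.1‖ ^ 2 + ‖q.2 - p.2‖ ^ 2) ≤ K},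
      ((rQ q p : ℝ) : EReal)) ≤ 0

/-- A quasidense set contains points at which `rQ` is as small as desired. -/
theorem Quasidense.exists_rQ_lt {A : Set (E × (E →L[ℝ] ℝ))} (hA : Quasidense A)
    (w : E × (E →L[ℝ] ℝ)) {η : ℝ} (hη : 0 < η) : ∃ q ∈ A, rQ q w < η := by
  have h : (⨅ q ∈ A, ((rQ q w : ℝ) : EReal)) < (η : EReal) :=
    (hA w).trans_lt (by exact_mod_cast hη)
  simp only [iInf_lt_iff] at h
  obtain ⟨q, hq, hlt⟩ := h
  exact ⟨q, hq, by exact_mod_cast hlt⟩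

/-- A closed quasidense set is of type (ANA), whether or not it is monotone. -/
theorem Quasidense.exists_negative_alignment {A : Set (E × (E →L[ℝ] ℝ))} (hA : Quasidense A)
    (hclosed : IsClosed A) {w : E × (E →L[ℝ] ℝ)} (hw : w ∉ A) {ε : ℝ} (hε : 0 < ε) :
    ∃ q ∈ A, q.1 ≠ w.1 ∧ q.2 ≠ w.2 ∧
      (q.2 - w.2) (q.1 - w.1) / (‖q.1 - w.1‖ * ‖q.2 - w.2‖) < -1 + ε := by
  obtain ⟨δ, hδ, hball⟩ := Metric.isOpen_iff.mp hclosed.isOpen_compl w hw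
  obtain ⟨q, hq, hlt⟩ := hA.exists_rQ_lt w
    (η := min (δ ^ 2 / 8) (ε * (δ ^ 2 / 4))) (by positivity)
  obtain ⟨hlt₁, hlt₂⟩ := lt_min_iff.mp hlt
  have hfar : δ ≤ ‖q.1 - w.1‖ ∨ δ ≤ ‖q.2 - w.2‖ := by
    by_contra! hnear
    refine hball (a := q) ?_ hq
    rw [Metric.mem_ball, Prod.dist_eq, dist_eq_norm, dist_eq_norm]
    exact max_lt hnear.1 hnear.2
  have hpair : -(‖q.1 - w.1‖ * ‖q.2 - w.2‖) ≤ (q.2 - w.2) (q.1 - w.1) := by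
    have h := (q.2 - w.2).le_opNorm (q.1 - w.1)
    rw [Real.norm_eq_abs, mul_comm] at h
    exact (abs_le.mp h).1
  unfold rQ at hlt₁ hlt₂
  have hne : ∀ {F : Type _} [NormedAddCommGroup F] {x y : F}, 0 < ‖x - y‖ → x ≠ y :=
    fun h => sub_ne_zero.mp (norm_pos_iff.mp h)
  suffices hhalf : δ / 2 < ‖q.1 - w.1‖ ∧ δ / 2 < ‖q.2 - w.2‖ by
    obtain ⟨h₁, h₂⟩ := hhalf
    have hpos₁ : 0 < ‖q.1 - w.1‖ := by linarith
    have hpos₂ : 0 < ‖q.2 - w.2‖ := by linarith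
    refine ⟨q, hq, hne hpos₁, hne hpos₂, ?_⟩
    rw [div_lt_iff₀ (mul_pos hpos₁ hpos₂)]
    have hprod : δ ^ 2 / 4 ≤ ‖q.1 - w.1‖ * ‖q.2 - w.2‖ := by nlinarith
    have := mul_le_mul_of_nonneg_left hprod hε.le
    nlinarith [sq_nonneg (‖q.1 - w.1‖ - ‖q.2 - w.2‖)]
  have hdiff : |‖q.1 - w.1‖ - ‖q.2 - w.2‖| < δ / 2 :=
    abs_lt_of_sq_lt_sq (by nlinarith) (by positivity)
  obtain ⟨hd₁, hd₂⟩ := abs_lt.mp hdiff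
  rcases hfar with h | h <;> constructor <;> linarith

theorem statement18 [CompleteSpace E] [Nontrivial E]
    (A : Set (E × (E →L[ℝ] ℝ))) (hclosed : IsClosed A)
    (hmono : MonotoneSet A) (hqd : Quasidense A) :
    MaxMonotone A ∧
      ∀ w : E × (E →L[ℝ] ℝ), w ∉ A → ∀ ε : ℝ, 0 < ε →
        ∃ q ∈ A, q.1 ≠ w.1 ∧ q.2 ≠ w.2 ∧
          (q.2 - w.2) (q.1 - w.1) / (‖q.1 - w.1‖ * ‖q.2 - w.2‖) < -1 + ε := by
  have hana := fun (w : E × (E →L[ℝ] ℝ)) (hw : w ∉ A) (ε : ℝ) (hε : 0 < ε) =>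
    hqd.exists_negative_alignment hclosed hw hε
  refine ⟨⟨hmono, fun A' hA' hsub => (hsub.antisymm fun w hw => ?_).symm⟩, hana⟩
  by_contra hwA
  obtain ⟨q, hq, -, -, hlt⟩ := hana w hwA 1 one_pos
  have : 0 ≤ (q.2 - w.2) (q.1 - w.1) / (‖q.1 - w.1‖ * ‖q.2 - w.2‖) :=
    div_nonneg (hA'.2 q (hsub hq) w hw) (by positivity)
  linarith
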